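/- For every γ ∈ (0, γ₀], P is a bounded linear operator on 𝓑_γ, and 𝓑_γ = ℂ·1 ⊕ H_γ, where H_γ = {f ∈ 𝓑_γ : ν(f) = 0} is a closed P-invariant subspace of 𝓑_γ on which the spectral radius of the restriction of P satisfies r(P|_{H_γ}) ≤ ϑ₀^{1/n₀} < 1. Equivalently, for all n ≥ 1 and f ∈ 𝓑_γ, Pⁿf = ν(f)·1 + N_{(γ)}ⁿ f with N_{(γ)} ∈ 𝓛(𝓑_γ) of spectral radius at most ϑ₀^{1/n₀}. -/

import Mathlib

open MeasureTheory ProbabilityTheory Filter Topology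
open scoped ENNReal NNReal

noncomputable section

/-- `p_λ(x) = 1 + λ d(x,x₀)` -/
def pfun {M : Type*} [MetricSpace M] (x₀ : M) (lam : ℝ) (x : M) : ℝ :=
  1 + lam * dist x x₀

/-- `δ_λ(g) = max{c(g),1} + λ d(g x₀, x₀)` -/
def deltaFun {M G : Type*} [MetricSpace M] (x₀ : M) (act : G → M → M) (c : G → ℝ)
    (lam : ℝ) (g : G) : ℝ :=
  max (c g) 1 + lam * dist (act g x₀) x₀

/-- `δ̃(g) = 1 + c(g) + d(g x₀, x₀)` -/
def deltaTilde {M G : Type*} [MetricSpace M] (x₀ : M) (act : G → M → M) (c : G → ℝ)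
    (g : G) : ℝ :=
  1 + c g + dist (act g x₀) x₀

/-- the weight `Δ_γ(x,y) = d(x,y) p(x)^γ p(y)^γ` -/
def wDelta {M : Type*} [MetricSpace M] (x₀ : M) (lam γ : ℝ) (x y : M) : ℝ :=
  dist x y * pfun x₀ lam x ^ γ * pfun x₀ lam y ^ γ

/-- `m_γ(f)`, the best Lipschitz-type constant of `f` w.r.t. the weight `Δ_γ` -/
def mGam {M : Type*} [MetricSpace M] (x₀ : M) (lam γ : ℝ) (f : M → ℂ) : ℝ :=
  sSup {ρ : ℝ | ∃ x y : M, x ≠ y ∧ ρ = ‖f x - f y‖ / wDelta x₀ lam γ x y}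

/-- `|f|_η = sup_x |f(x)|/p(x)^{η+1}` -/
def nrmGam {M : Type*} [MetricSpace M] (x₀ : M) (lam η : ℝ) (f : M → ℂ) : ℝ :=
  sSup {ρ : ℝ | ∃ x : M, ρ = ‖f x‖ / pfun x₀ lam x ^ (η + 1)}

/-- membership in the space `𝓑_γ` -/
def memB {M : Type*} [MetricSpace M] (x₀ : M) (lam γ : ℝ) (f : M → ℂ) : Prop :=
  ∃ K : ℝ, ∀ x y : M, ‖f x - f y‖ ≤ K * wDelta x₀ lam γ x y

/-- the norm `N_{∞,γ}` on `𝓑_γ` -/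
def nInf {M : Type*} [MetricSpace M] (x₀ : M) (lam γ : ℝ) (f : M → ℂ) : ℝ :=
  mGam x₀ lam γ f + nrmGam x₀ lam γ f

/-- the Markov transition operator `P` acting on complex functions -/
def Pop {M G : Type*} [MeasurableSpace G] (π : Measure G) (act : G → M → M)
    (f : M → ℂ) (x : M) : ℂ :=
  ∫ g, f (act g x) ∂π

/-- the Markov transition operator `P` acting on real functions -/
def PopR {M G : Type*} [MeasurableSpace G] (π : Measure G) (act : G → M → M)
    (f : M → ℝ) (x : M) : ℝ :=
  ∫ g, f (act g x) ∂π

/-- the Fourier kernel `P(t)` -/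
def Pt {M G : Type*} [MeasurableSpace G] (π : Measure G) (act : G → M → M)
    (ξ : G → M → ℝ) (t : ℝ) (f : M → ℂ) (x : M) : ℂ :=
  ∫ g, Complex.exp (Complex.I * (t * ξ g x)) * f (act g x) ∂π

/-- the derivative kernels `L_k` -/
def Lk {M G : Type*} [MeasurableSpace G] (π : Measure G) (act : G → M → M)
    (ξ : G → M → ℝ) (k : ℕ) (f : M → ℂ) (x : M) : ℂ :=
  ∫ g, (Complex.I * (ξ g x : ℂ)) ^ k * f (act g x) ∂π

/-- `piStar π n` is the convolution power `π^{*(n+1)}`, the law of `R_{n+1} = Y_{n+1} ⋯ Y₁`. -/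
def piStar {G : Type*} [MeasurableSpace G] [Mul G] (π : Measure G) : ℕ → Measure G
  | 0 => π
  | n + 1 => Measure.map (fun q : G × G => q.1 * q.2) (π.prod (piStar π n))

/-- `ϑ₀ = ∫ c(g) δ_{λ₀}(g)^{2γ₀} dπ^{*n₀}(g)` (with `n₀` shifted by one). -/
def theta0 {M G : Type*} [MetricSpace M] [MeasurableSpace G] [Mul G] (x₀ : M)
    (act : G → M → M) (c : G → ℝ) (π : Measure G) (lam₀ γ₀ : ℝ) (n₀ : ℕ) : ℝ :=
  ∫ g, c g * deltaFun x₀ act c lam₀ g ^ (2 * γ₀) ∂(piStar π n₀)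

/-- `𝓙^τ(U,V)` as a lower integral. -/
def Jtau {M G : Type*} [MetricSpace M] [MeasurableSpace G] (x₀ : M) (act : G → M → M)
    (c : G → ℝ) (π : Measure G) (τ : ℝ) (U V : G → ℝ) : ℝ≥0∞ :=
  (∫⁻ g, ENNReal.ofReal (U g * (c g * deltaTilde x₀ act c g ^ (2 * τ))) ∂π) +
    ∫⁻ g, ENNReal.ofReal (V g * deltaTilde x₀ act c g ^ (τ + 1)) ∂π

/-- the random trajectory `Z_n`: `traj act Y Z n = R_n Z` where `R_n = Y_n ⋯ Y₁`
(`Y k` stands for `Y_{k+1}`). -/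
def traj {M G Ω : Type*} (act : G → M → M) (Y : ℕ → Ω → G) (Z : Ω → M) : ℕ → Ω → M
  | 0 => Z
  | n + 1 => fun ω => act (Y n ω) (traj act Y Z n ω)

/-- `S_n^Z = Σ_{k=1}^n ξ(Y_k, Z_{k-1})` -/
def Sn {M G Ω : Type*} (act : G → M → M) (ξ : G → M → ℝ) (Y : ℕ → Ω → G) (Z : Ω → M)
    (n : ℕ) (ω : Ω) : ℝ :=
  ∑ k ∈ Finset.range n, ξ (Y k ω) (traj act Y Z k ω)

/-- convergence in distribution, expressed through bounded continuous test functions -/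
def CvgInDist {Ω : Type*} [MeasurableSpace Ω] (P : Measure Ω) (X : ℕ → Ω → ℝ)
    (μ : Measure ℝ) : Prop :=
  ∀ f : ℝ → ℝ, Continuous f → (∃ C : ℝ, ∀ x, |f x| ≤ C) →
    Tendsto (fun n => ∫ ω, f (X n ω) ∂P) atTop (𝓝 (∫ x, f x ∂μ))

/-- the topological support of a measure -/
def msupport {M : Type*} [TopologicalSpace M] [MeasurableSpace M] (ν : Measure M) : Set M :=
  {x | ∀ U : Set M, IsOpen U → x ∈ U → 0 < ν U}

/-- the product `h* = h₁ ⋯ h_{k+1}` of a tuple of elements of the semigroup `G` -/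
def hstar {G : Type*} [Semigroup G] : ∀ {k : ℕ}, (Fin (k + 1) → G) → G
  | 0, h => h 0
  | _ + 1, h => h 0 * hstar (Fin.tail h)


/-- the norm `N_γ(f) = m_γ(f) + |ν(f)|` -/
def nNu {M : Type*} [MetricSpace M] [MeasurableSpace M] (x₀ : M) (lam γ : ℝ)
    (ν : Measure M) (f : M → ℂ) : ℝ :=
  mGam x₀ lam γ f + ‖∫ x, f x ∂ν‖


/-- A finite function satisfying a geometric drift condition is integrable with respect to any
invariant probability measure. -/
lemma lintegral_lt_top_of_drift {M G : Type*} [MeasurableSpace M] [MeasurableSpace G]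
    {act : G → M → M} {μ : Measure G} [IsProbabilityMeasure μ] {ν : Measure M}
    [IsProbabilityMeasure ν]
    (hinv : ∀ W : M → ℝ≥0∞, Measurable W →
      ∫⁻ x, ∫⁻ g, W (act g x) ∂μ ∂ν = ∫⁻ x, W x ∂ν)
    {V : M → ℝ≥0∞} (hV : Measurable V) (hVact : ∀ x, Measurable fun g => V (act g x))
    (hVtop : ∀ x, V x ≠ ⊤) {κ B : ℝ≥0∞} (hκ : κ < 1) (hB : B ≠ ⊤)
    (hdrift : ∀ x, ∫⁻ g, V (act g x) ∂μ ≤ κ * V x + B) :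
    ∫⁻ x, V x ∂ν < ⊤ := by
  set D := B * (1 - κ)⁻¹ with hD
  have hDtop : D < ⊤ := ENNReal.mul_lt_top hB.lt_top
    (ENNReal.inv_lt_top.2 (tsub_pos_of_lt hκ))
  have hstep : ∀ a b A : ℝ≥0∞, ∫⁻ x, min (a * V x + b) A ∂ν
      ≤ ∫⁻ x, min (a * κ * V x + (b + B * a)) A ∂ν := fun a b A => by
    rw [← hinv _ (((hV.const_mul a).add_const b).min measurable_const)]
    refine lintegral_mono fun x => le_min ?_ ?_
    · calc ∫⁻ g, min (a * V (act g x) + b) A ∂μ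
          ≤ ∫⁻ g, (a * V (act g x) + b) ∂μ := lintegral_mono fun g => min_le_left _ _
        _ = a * ∫⁻ g, V (act g x) ∂μ + b := by
            rw [lintegral_add_right _ measurable_const, lintegral_const_mul _ (hVact x)]
            simp
        _ ≤ a * (κ * V x + B) + b := by gcongr; exact hdrift x
        _ = a * κ * V x + (b + B * a) := by ring
    · exact (lintegral_mono fun g => min_le_right _ _).trans (by simp)
  have hiter : ∀ (A : ℝ≥0∞) (k : ℕ), ∫⁻ x, min (V x) A ∂ν
      ≤ ∫⁻ x, min (κ ^ k * V x + B * ∑ i ∈ Finset.range k, κ ^ i) A ∂ν := fun A k => by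
    induction k with
    | zero => simp
    | succ k ih =>
      refine (ih.trans (hstep _ _ A)).trans_eq ?_
      simp only [Finset.sum_range_succ, pow_succ, mul_add]
  have hiter' : ∀ (A : ℝ≥0∞) (k : ℕ), ∫⁻ x, min (V x) A ∂ν
      ≤ ∫⁻ x, min (κ ^ k * V x + D) A ∂ν := fun A k => by
    refine (hiter A k).trans (lintegral_mono fun x => ?_)
    have : ∑ i ∈ Finset.range k, κ ^ i ≤ (1 - κ)⁻¹ :=
      (ENNReal.sum_le_tsum _).trans_eq (ENNReal.tsum_geometric κ)
    dsimp only
    rw [hD]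
    gcongr
  have hbound : ∀ n : ℕ, ∫⁻ x, min (V x) n ∂ν ≤ D := fun n => by
    have hlim : Tendsto (fun k : ℕ => ∫⁻ x, min (κ ^ k * V x + D) n ∂ν) atTop
        (𝓝 (∫⁻ _, min D n ∂ν)) := by
      refine tendsto_lintegral_of_dominated_convergence (fun _ => (n : ℝ≥0∞))
        (fun k => ((hV.const_mul _).add_const _).min measurable_const)
        (fun k => ae_of_all _ fun x => min_le_right _ _) (by simp)
        (ae_of_all _ fun x => ?_)
      have h1 : Tendsto (fun k : ℕ => κ ^ k * V x) atTop (𝓝 (0 * V x)) :=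
        ENNReal.Tendsto.mul_const (ENNReal.tendsto_pow_atTop_nhds_zero_of_lt_one hκ)
          (Or.inr (hVtop x))
      rw [zero_mul] at h1
      simpa using (h1.add_const D).min (tendsto_const_nhds (x := (n : ℝ≥0∞)))
    calc ∫⁻ x, min (V x) n ∂ν ≤ ∫⁻ _, min D n ∂ν := ge_of_tendsto' hlim (hiter' n)
      _ ≤ D := by simp
  refine lt_of_le_of_lt ?_ hDtop
  have hmono : Tendsto (fun n : ℕ => ∫⁻ x, min (V x) n ∂ν) atTop (𝓝 (∫⁻ x, V x ∂ν)) := by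
    refine lintegral_tendsto_of_tendsto_of_monotone
      (fun n => (hV.min measurable_const).aemeasurable)
      (ae_of_all _ fun x m n hmn => ?_) (ae_of_all _ fun x => ?_)
    · dsimp only
      gcongr
    · have := (tendsto_const_nhds (x := V x)).min ENNReal.tendsto_nat_nhds_top
      simpa using this
  exact le_of_tendsto' hmono hbound

/-- A measurable action of a semigroup by Lipschitz self-maps with optimal constants `c`. -/
structure IsLipAction {M G : Type*} [MetricSpace M] [MeasurableSpace M] [Semigroup G]
    [MeasurableSpace G] (act : G → M → M) (c : G → ℝ) : Prop where
  mul_act : ∀ (g h : G) (x : M), act (g * h) x = act g (act h x)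
  measurable_act : Measurable fun q : G × M => act q.1 q.2
  measurable_lip : Measurable c
  nonneg : ∀ g : G, 0 ≤ c g
  dist_le : ∀ (g : G) (x y : M), dist (act g x) (act g y) ≤ c g * dist x y
  le_of_dist_le : ∀ (g : G) (K : ℝ), 0 ≤ K →
    (∀ x y : M, dist (act g x) (act g y) ≤ K * dist x y) → c g ≤ K

section Weights

variable {M : Type*} [MetricSpace M] {x₀ : M} {lam γ : ℝ}

lemma one_le_pfun (hl : 0 ≤ lam) (x : M) : 1 ≤ pfun x₀ lam x := by
  unfold pfun
  have := mul_nonneg hl (dist_nonneg (x := x) (y := x₀))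
  linarith

lemma pfun_rpow_nonneg (hl : 0 ≤ lam) (x : M) : 0 ≤ pfun x₀ lam x ^ γ :=
  Real.rpow_nonneg (zero_le_one.trans (one_le_pfun hl x)) γ

lemma pfun_base : pfun x₀ lam x₀ = 1 := by simp [pfun]

lemma wDelta_nonneg (hl : 0 ≤ lam) (x y : M) : 0 ≤ wDelta x₀ lam γ x y :=
  mul_nonneg (mul_nonneg dist_nonneg (pfun_rpow_nonneg hl x)) (pfun_rpow_nonneg hl y)

lemma wDelta_pos (hl : 0 ≤ lam) {x y : M} (h : x ≠ y) : 0 < wDelta x₀ lam γ x y := by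
  have hp : ∀ z : M, 0 < pfun x₀ lam z ^ γ := fun z =>
    Real.rpow_pos_of_pos (zero_lt_one.trans_le (one_le_pfun hl z)) γ
  exact mul_pos (mul_pos (dist_pos.2 h) (hp x)) (hp y)

lemma wDelta_base (x : M) : wDelta x₀ lam γ x x₀ = dist x x₀ * pfun x₀ lam x ^ γ := by
  simp [wDelta, pfun_base]

lemma continuous_pfun_rpow (hl : 0 ≤ lam) : Continuous fun x : M => pfun x₀ lam x ^ γ := by
  refine Continuous.rpow_const (by unfold pfun; fun_prop) fun x => Or.inl ?_
  exact (zero_lt_one.trans_le (one_le_pfun hl x)).ne'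

lemma continuous_wDelta_left (hl : 0 ≤ lam) (y : M) :
    Continuous fun x : M => wDelta x₀ lam γ x y := by
  have := continuous_pfun_rpow (x₀ := x₀) (γ := γ) hl
  unfold wDelta
  fun_prop

lemma mGam_nonneg (hl : 0 ≤ lam) (f : M → ℂ) : 0 ≤ mGam x₀ lam γ f := by
  refine Real.sSup_nonneg ?_
  rintro _ ⟨x, y, -, rfl⟩
  exact div_nonneg (norm_nonneg _) (wDelta_nonneg hl x y)

lemma mGam_le (hl : 0 ≤ lam) {f : M → ℂ} {K : ℝ} (hK : 0 ≤ K)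
    (h : ∀ x y : M, ‖f x - f y‖ ≤ K * wDelta x₀ lam γ x y) : mGam x₀ lam γ f ≤ K := by
  refine Real.sSup_le ?_ hK
  rintro _ ⟨x, y, hxy, rfl⟩
  exact (div_le_iff₀ (wDelta_pos hl hxy)).2 (h x y)

lemma memB.norm_sub_le (hl : 0 ≤ lam) {f : M → ℂ} (hf : memB x₀ lam γ f) (x y : M) :
    ‖f x - f y‖ ≤ mGam x₀ lam γ f * wDelta x₀ lam γ x y := by
  rcases eq_or_ne x y with rfl | hxy
  · simp [wDelta]
  rw [← div_le_iff₀ (wDelta_pos hl hxy)]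
  obtain ⟨K, hK⟩ := hf
  refine le_csSup ⟨K, ?_⟩ ⟨x, y, hxy, rfl⟩
  rintro _ ⟨x, y, hxy, rfl⟩
  exact (div_le_iff₀ (wDelta_pos hl hxy)).2 (hK x y)

lemma memB.norm_le (hl : 0 ≤ lam) {f : M → ℂ} (hf : memB x₀ lam γ f) (x : M) :
    ‖f x‖ ≤ ‖f x₀‖ + mGam x₀ lam γ f * wDelta x₀ lam γ x x₀ := by
  have h1 := hf.norm_sub_le hl x x₀
  have h2 := norm_sub_norm_le (f x) (f x₀)
  linarith

lemma memB.continuous (hl : 0 ≤ lam) {f : M → ℂ} (hf : memB x₀ lam γ f) : Continuous f := by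
  refine continuous_iff_continuousAt.2 fun x => ?_
  rw [ContinuousAt, tendsto_iff_norm_sub_tendsto_zero]
  refine squeeze_zero (fun _ => norm_nonneg _) (fun y => hf.norm_sub_le hl y x) ?_
  have := ((continuous_wDelta_left (x₀ := x₀) (γ := γ) hl x).tendsto x).const_mul
    (mGam x₀ lam γ f)
  simpa [wDelta] using this

lemma memB.sub_const {f : M → ℂ} (hf : memB x₀ lam γ f) (a : ℂ) :
    memB x₀ lam γ (fun x => f x - a) := by
  simpa [memB] using hf

lemma mGam_sub_const (f : M → ℂ) (a : ℂ) :
    mGam x₀ lam γ (fun x => f x - a) = mGam x₀ lam γ f := by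
  simp [mGam]

lemma mGam_le_nNu [MeasurableSpace M] (ν : Measure M) (f : M → ℂ) :
    mGam x₀ lam γ f ≤ nNu x₀ lam γ ν f :=
  le_add_of_nonneg_right (norm_nonneg _)

/-- `p^γ` is negligible with respect to `d(·,x₀) p^γ`, up to constants. -/
lemma pfun_rpow_le_mul_wDelta_add (hl : 0 ≤ lam) (hγ : 0 ≤ γ) {ε : ℝ} (hε : 0 < ε) (x : M) :
    pfun x₀ lam x ^ γ ≤ ε * wDelta x₀ lam γ x x₀ + (1 + lam * ε⁻¹) ^ γ := by
  have hp := pfun_rpow_nonneg (x₀ := x₀) (γ := γ) hl x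
  have hw := wDelta_nonneg (x₀ := x₀) (γ := γ) hl x x₀
  have hc : 0 ≤ (1 + lam * ε⁻¹) ^ γ := by positivity
  rcases le_total (dist x x₀) ε⁻¹ with h | h
  · have : pfun x₀ lam x ^ γ ≤ (1 + lam * ε⁻¹) ^ γ := by
      refine Real.rpow_le_rpow (zero_le_one.trans (one_le_pfun hl x)) ?_ hγ
      unfold pfun
      gcongr
    have := mul_nonneg hε.le hw
    linarith
  · have h1 : 1 ≤ ε * dist x x₀ := by
      rwa [inv_eq_one_div, div_le_iff₀' hε] at h
    rw [wDelta_base, ← mul_assoc]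
    nlinarith [mul_le_mul_of_nonneg_right h1 hp]

variable {G : Type*} {act : G → M → M} {c : G → ℝ}

lemma one_le_deltaFun (hl : 0 ≤ lam) (g : G) : 1 ≤ deltaFun x₀ act c lam g := by
  have := mul_nonneg hl (dist_nonneg (x := act g x₀) (y := x₀))
  unfold deltaFun
  linarith [le_max_right (c g) 1]

lemma le_deltaFun (hl : 0 ≤ lam) (g : G) : c g ≤ deltaFun x₀ act c lam g := by
  have := mul_nonneg hl (dist_nonneg (x := act g x₀) (y := x₀))
  unfold deltaFun
  linarith [le_max_left (c g) 1]

lemma dist_base_le_deltaFun (hl : 0 < lam) (g : G) :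
    dist (act g x₀) x₀ ≤ lam⁻¹ * deltaFun x₀ act c lam g := by
  rw [inv_mul_eq_div, le_div_iff₀' hl]
  unfold deltaFun
  linarith [le_max_right (c g) 1]

end Weights

section Action

variable {M G : Type*} [MetricSpace M] [MeasurableSpace M] [Semigroup G] [MeasurableSpace G]
  {x₀ : M} {act : G → M → M} {c : G → ℝ} {lam γ : ℝ}

namespace IsLipAction

lemma deltaFun_le_deltaTilde (H : IsLipAction act c) (hl1 : lam ≤ 1) (g : G) :
    deltaFun x₀ act c lam g ≤ deltaTilde x₀ act c g := by
  have h1 : max (c g) 1 ≤ 1 + c g := max_le (by linarith) (by linarith [H.nonneg g])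
  have h2 := mul_le_of_le_one_left (dist_nonneg (x := act g x₀) (y := x₀)) hl1
  unfold deltaFun deltaTilde
  linarith

lemma const_mul_le (H : IsLipAction act c) (g h : G) : c (g * h) ≤ c g * c h := by
  refine H.le_of_dist_le _ _ (mul_nonneg (H.nonneg g) (H.nonneg h)) fun x y => ?_
  rw [H.mul_act, H.mul_act, mul_assoc]
  exact (H.dist_le g _ _).trans (mul_le_mul_of_nonneg_left (H.dist_le h x y) (H.nonneg g))

lemma dist_base_le (H : IsLipAction act c) (g : G) (x : M) :
    dist (act g x) x₀ ≤ c g * dist x x₀ + dist (act g x₀) x₀ :=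
  (dist_triangle _ (act g x₀) _).trans (add_le_add_left (H.dist_le g x x₀) _)

lemma deltaFun_mul_le (H : IsLipAction act c) (hl : 0 ≤ lam) (g h : G) :
    deltaFun x₀ act c lam (g * h) ≤ deltaFun x₀ act c lam g * deltaFun x₀ act c lam h := by
  have hg0 := H.nonneg g
  have hg : 1 ≤ max (c g) 1 := le_max_right _ _
  have hg' : c g ≤ max (c g) 1 := le_max_left _ _
  have hh : 1 ≤ max (c h) 1 := le_max_right _ _
  have hh' : c h ≤ max (c h) 1 := le_max_left _ _
  have hd := H.dist_base_le (x₀ := x₀) g (act h x₀)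
  rw [← H.mul_act] at hd
  have bg := mul_nonneg hl (dist_nonneg (x := act g x₀) (y := x₀))
  have bh := mul_nonneg hl (dist_nonneg (x := act h x₀) (y := x₀))
  have hm : max (c (g * h)) 1 ≤ max (c g) 1 * max (c h) 1 :=
    max_le ((H.const_mul_le g h).trans (mul_le_mul hg' hh' (H.nonneg h) (by linarith)))
      (one_le_mul_of_one_le_of_one_le hg hh)
  have hld := mul_le_mul_of_nonneg_left hd hl
  unfold deltaFun
  nlinarith [mul_le_mul_of_nonneg_right hg' bh, mul_le_mul_of_nonneg_left hh bg,
    mul_nonneg bg bh]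

lemma pfun_act_le (H : IsLipAction act c) (hl : 0 ≤ lam) (g : G) (x : M) :
    pfun x₀ lam (act g x) ≤ deltaFun x₀ act c lam g * pfun x₀ lam x := by
  have hd := mul_le_mul_of_nonneg_left (H.dist_base_le (x₀ := x₀) g x) hl
  have bg := mul_nonneg hl (dist_nonneg (x := act g x₀) (y := x₀))
  have bx := mul_nonneg hl (dist_nonneg (x := x) (y := x₀))
  have hg : 1 ≤ max (c g) 1 := le_max_right _ _
  have hg' : c g ≤ max (c g) 1 := le_max_left _ _
  unfold deltaFun pfun
  nlinarith [mul_le_mul_of_nonneg_right hg' bx, mul_nonneg bg bx]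

lemma pfun_act_rpow_le (H : IsLipAction act c) (hl : 0 ≤ lam) (hγ : 0 ≤ γ) (g : G) (x : M) :
    pfun x₀ lam (act g x) ^ γ ≤ deltaFun x₀ act c lam g ^ γ * pfun x₀ lam x ^ γ := by
  rw [← Real.mul_rpow (zero_le_one.trans (one_le_deltaFun hl g))
    (zero_le_one.trans (one_le_pfun hl x))]
  exact Real.rpow_le_rpow (zero_le_one.trans (one_le_pfun hl _)) (H.pfun_act_le hl g x) hγ

lemma wDelta_act_le (H : IsLipAction act c) (hl : 0 ≤ lam) (hγ : 0 ≤ γ) (g : G) (x y : M) :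
    wDelta x₀ lam γ (act g x) (act g y)
      ≤ c g * deltaFun x₀ act c lam g ^ (2 * γ) * wDelta x₀ lam γ x y := by
  have hδ : 0 < deltaFun x₀ act c lam g := zero_lt_one.trans_le (one_le_deltaFun hl g)
  have e : c g * deltaFun x₀ act c lam g ^ (2 * γ) * wDelta x₀ lam γ x y
      = (c g * dist x y) * (deltaFun x₀ act c lam g ^ γ * pfun x₀ lam x ^ γ)
        * (deltaFun x₀ act c lam g ^ γ * pfun x₀ lam y ^ γ) := by
    rw [two_mul, Real.rpow_add hδ]
    unfold wDelta
    ring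
  have := H.nonneg g
  have := Real.rpow_nonneg hδ.le γ
  have hp := fun z : M => pfun_rpow_nonneg (x₀ := x₀) (γ := γ) hl z
  have := hp x
  have := hp y
  have := hp (act g x)
  have := hp (act g y)
  rw [e]
  unfold wDelta
  gcongr
  · exact H.dist_le g x y
  · exact H.pfun_act_rpow_le hl hγ g x
  · exact H.pfun_act_rpow_le hl hγ g y

lemma wDelta_act_base_le (H : IsLipAction act c) (hl : 0 < lam) (hγ : 0 ≤ γ) (g : G) (x : M) :
    wDelta x₀ lam γ (act g x) x₀
      ≤ c g * deltaFun x₀ act c lam g ^ (2 * γ) * wDelta x₀ lam γ x x₀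
        + lam⁻¹ * deltaFun x₀ act c lam g ^ (γ + 1) * pfun x₀ lam x ^ γ := by
  have hδ1 := one_le_deltaFun (x₀ := x₀) (act := act) (c := c) hl.le g
  set δ := deltaFun x₀ act c lam g with hδdef
  have hδ : 0 < δ := zero_lt_one.trans_le hδ1
  have hc := H.nonneg g
  have hp := pfun_rpow_nonneg (x₀ := x₀) (γ := γ) hl.le x
  have hδγ := Real.rpow_nonneg hδ.le γ
  rw [wDelta_base, wDelta_base]
  calc dist (act g x) x₀ * pfun x₀ lam (act g x) ^ γ
      ≤ (c g * dist x x₀ + lam⁻¹ * δ) * (δ ^ γ * pfun x₀ lam x ^ γ) :=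
        mul_le_mul ((H.dist_base_le g x).trans (by gcongr; exact dist_base_le_deltaFun hl g))
          (H.pfun_act_rpow_le hl.le hγ g x) (pfun_rpow_nonneg hl.le _) (by positivity)
    _ = c g * δ ^ γ * (dist x x₀ * pfun x₀ lam x ^ γ)
        + lam⁻¹ * δ ^ (γ + 1) * pfun x₀ lam x ^ γ := by
        rw [Real.rpow_add hδ, Real.rpow_one]
        ring
    _ ≤ _ := by
        gcongr
        linarith

lemma measurable_act_left (H : IsLipAction act c) (x : M) : Measurable fun g => act g x :=
  H.measurable_act.comp measurable_prodMk_right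

lemma integral_lip_mul_nonneg {μ : Measure G} (H : IsLipAction act c) (hl : 0 ≤ lam) :
    0 ≤ ∫ g, c g * deltaFun x₀ act c lam g ^ (2 * γ) ∂μ :=
  integral_nonneg fun g => mul_nonneg (H.nonneg g)
    (Real.rpow_nonneg (zero_le_one.trans (one_le_deltaFun hl g)) _)

variable [BorelSpace M]

lemma measurable_deltaFun (H : IsLipAction act c) : Measurable (deltaFun x₀ act c lam) := by
  have h1 : Measurable fun g => dist (act g x₀) x₀ :=
    (by fun_prop : Continuous fun y : M => dist y x₀).measurable.comp (H.measurable_act_left x₀)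
  exact (H.measurable_lip.max measurable_const).add (h1.const_mul lam)

end IsLipAction

end Action

section Operator

variable {M G : Type*} [MetricSpace M] [MeasurableSpace M] [BorelSpace M]
  [Semigroup G] [MeasurableSpace G]
  {x₀ : M} {act : G → M → M} {c : G → ℝ} {lam γ : ℝ} {μ : Measure G}

namespace IsLipAction

lemma integrable_comp_act [IsProbabilityMeasure μ] (H : IsLipAction act c) (hl : 0 < lam)
    (hγ : 0 ≤ γ)
    (h1 : Integrable (fun g => c g * deltaFun x₀ act c lam g ^ (2 * γ)) μ)
    (h2 : Integrable (fun g => deltaFun x₀ act c lam g ^ (γ + 1)) μ)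
    {f : M → ℂ} (hf : memB x₀ lam γ f) (x : M) : Integrable (fun g => f (act g x)) μ := by
  refine Integrable.mono' (g := fun g => ‖f x₀‖ + mGam x₀ lam γ f *
    (c g * deltaFun x₀ act c lam g ^ (2 * γ) * wDelta x₀ lam γ x x₀
        + lam⁻¹ * deltaFun x₀ act c lam g ^ (γ + 1) * pfun x₀ lam x ^ γ)) ?_ ?_ ?_
  · exact (integrable_const _).add
      (((h1.mul_const _).add ((h2.const_mul _).mul_const _)).const_mul _)
  · exact ((hf.continuous hl.le).measurable.comp
      (H.measurable_act_left x)).aestronglyMeasurable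
  · refine ae_of_all _ fun g => (hf.norm_le hl.le _).trans ?_
    gcongr
    · exact mGam_nonneg hl.le f
    · exact H.wDelta_act_base_le hl hγ g x

lemma norm_Pop_sub_le [IsProbabilityMeasure μ] (H : IsLipAction act c) (hl : 0 < lam)
    (hγ : 0 ≤ γ)
    (h1 : Integrable (fun g => c g * deltaFun x₀ act c lam g ^ (2 * γ)) μ)
    (h2 : Integrable (fun g => deltaFun x₀ act c lam g ^ (γ + 1)) μ)
    {f : M → ℂ} (hf : memB x₀ lam γ f) (x y : M) :
    ‖Pop μ act f x - Pop μ act f y‖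
      ≤ (∫ g, c g * deltaFun x₀ act c lam g ^ (2 * γ) ∂μ) * mGam x₀ lam γ f
        * wDelta x₀ lam γ x y := by
  unfold Pop
  rw [← integral_sub (H.integrable_comp_act hl hγ h1 h2 hf x)
    (H.integrable_comp_act hl hγ h1 h2 hf y), mul_assoc, ← integral_mul_const]
  refine norm_integral_le_of_norm_le (h1.mul_const _) (ae_of_all _ fun g => ?_)
  calc ‖f (act g x) - f (act g y)‖
      ≤ mGam x₀ lam γ f * wDelta x₀ lam γ (act g x) (act g y) := hf.norm_sub_le hl.le _ _
    _ ≤ mGam x₀ lam γ f * (c g * deltaFun x₀ act c lam g ^ (2 * γ) * wDelta x₀ lam γ x y) :=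
        mul_le_mul_of_nonneg_left (H.wDelta_act_le hl.le hγ g x y) (mGam_nonneg hl.le f)
    _ = _ := by ring

lemma memB_Pop [IsProbabilityMeasure μ] (H : IsLipAction act c) (hl : 0 < lam)
    (hγ : 0 ≤ γ)
    (h1 : Integrable (fun g => c g * deltaFun x₀ act c lam g ^ (2 * γ)) μ)
    (h2 : Integrable (fun g => deltaFun x₀ act c lam g ^ (γ + 1)) μ)
    {f : M → ℂ} (hf : memB x₀ lam γ f) : memB x₀ lam γ (Pop μ act f) :=
  ⟨_, H.norm_Pop_sub_le hl hγ h1 h2 hf⟩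

lemma mGam_Pop_le [IsProbabilityMeasure μ] (H : IsLipAction act c) (hl : 0 < lam)
    (hγ : 0 ≤ γ)
    (h1 : Integrable (fun g => c g * deltaFun x₀ act c lam g ^ (2 * γ)) μ)
    (h2 : Integrable (fun g => deltaFun x₀ act c lam g ^ (γ + 1)) μ)
    {f : M → ℂ} (hf : memB x₀ lam γ f) :
    mGam x₀ lam γ (Pop μ act f)
      ≤ (∫ g, c g * deltaFun x₀ act c lam g ^ (2 * γ) ∂μ) * mGam x₀ lam γ f :=
  mGam_le hl.le (mul_nonneg (H.integral_lip_mul_nonneg hl.le) (mGam_nonneg hl.le f))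
    (H.norm_Pop_sub_le hl hγ h1 h2 hf)

lemma iterate_Pop [IsProbabilityMeasure μ] (H : IsLipAction act c) (hl : 0 < lam)
    (hγ : 0 ≤ γ)
    (h1 : Integrable (fun g => c g * deltaFun x₀ act c lam g ^ (2 * γ)) μ)
    (h2 : Integrable (fun g => deltaFun x₀ act c lam g ^ (γ + 1)) μ)
    {f : M → ℂ} (hf : memB x₀ lam γ f) (k : ℕ) :
    memB x₀ lam γ ((Pop μ act)^[k] f) ∧ mGam x₀ lam γ ((Pop μ act)^[k] f)
      ≤ (∫ g, c g * deltaFun x₀ act c lam g ^ (2 * γ) ∂μ) ^ k * mGam x₀ lam γ f := by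
  induction k with
  | zero => simpa using hf
  | succ k ih =>
    rw [Function.iterate_succ_apply', pow_succ', mul_assoc]
    exact ⟨H.memB_Pop hl hγ h1 h2 ih.1, (H.mGam_Pop_le hl hγ h1 h2 ih.1).trans
      (mul_le_mul_of_nonneg_left ih.2 (H.integral_lip_mul_nonneg hl.le))⟩

end IsLipAction

section Convolution

variable [MeasurableMul₂ G]

instance isProbabilityMeasure_piStar [IsProbabilityMeasure μ] (n : ℕ) :
    IsProbabilityMeasure (piStar μ n) := by
  induction n with
  | zero => exact ‹_›
  | succ n ih => exact Measure.isProbabilityMeasure_map measurable_mul.aemeasurable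

namespace IsLipAction

lemma integrable_deltaFun_rpow_piStar [IsProbabilityMeasure μ] (H : IsLipAction act c)
    (hl : 0 ≤ lam) {s : ℝ} (hs : 0 ≤ s)
    (h : Integrable (fun g => deltaFun x₀ act c lam g ^ s) μ) (n : ℕ) :
    Integrable (fun g => deltaFun x₀ act c lam g ^ s) (piStar μ n) := by
  induction n with
  | zero => exact h
  | succ n ih =>
    have hm : Measurable fun g => deltaFun x₀ act c lam g ^ s :=
      H.measurable_deltaFun.pow_const s
    refine (integrable_map_measure hm.aestronglyMeasurable measurable_mul.aemeasurable).2 ?_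
    refine (h.mul_prod ih).mono' (hm.comp measurable_mul).aestronglyMeasurable
      (ae_of_all _ fun q => ?_)
    have h0 : ∀ g, 0 ≤ deltaFun x₀ act c lam g := fun g =>
      zero_le_one.trans (one_le_deltaFun hl g)
    rw [Function.comp_apply, Real.norm_of_nonneg (Real.rpow_nonneg (h0 _) _),
      ← Real.mul_rpow (h0 _) (h0 _)]
    exact Real.rpow_le_rpow (h0 _) (H.deltaFun_mul_le hl _ _) hs

lemma integrable_lip_mul_piStar [IsProbabilityMeasure μ] (H : IsLipAction act c)
    (hl : 0 ≤ lam) (hγ : 0 ≤ γ)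
    (h : Integrable (fun g => c g * deltaFun x₀ act c lam g ^ (2 * γ)) μ) (n : ℕ) :
    Integrable (fun g => c g * deltaFun x₀ act c lam g ^ (2 * γ)) (piStar μ n) := by
  induction n with
  | zero => exact h
  | succ n ih =>
    have hm : Measurable fun g => c g * deltaFun x₀ act c lam g ^ (2 * γ) :=
      H.measurable_lip.mul (H.measurable_deltaFun.pow_const _)
    refine (integrable_map_measure hm.aestronglyMeasurable measurable_mul.aemeasurable).2 ?_
    refine (h.mul_prod ih).mono' (hm.comp measurable_mul).aestronglyMeasurable
      (ae_of_all _ fun q => ?_)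
    have h0 : ∀ g, 0 ≤ deltaFun x₀ act c lam g := fun g =>
      zero_le_one.trans (one_le_deltaFun hl g)
    rw [Function.comp_apply, Real.norm_of_nonneg
      (mul_nonneg (H.nonneg _) (Real.rpow_nonneg (h0 _) _)), mul_mul_mul_comm,
      ← Real.mul_rpow (h0 _) (h0 _)]
    exact mul_le_mul (H.const_mul_le _ _)
      (Real.rpow_le_rpow (h0 _) (H.deltaFun_mul_le hl _ _) (by positivity))
      (Real.rpow_nonneg (h0 _) _) (mul_nonneg (H.nonneg _) (H.nonneg _))

lemma Pop_piStar [IsProbabilityMeasure μ] (H : IsLipAction act c) (hl : 0 < lam)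
    (hγ : 0 ≤ γ)
    (h1 : Integrable (fun g => c g * deltaFun x₀ act c lam g ^ (2 * γ)) μ)
    (h2 : Integrable (fun g => deltaFun x₀ act c lam g ^ (γ + 1)) μ) (n : ℕ)
    {f : M → ℂ} (hf : memB x₀ lam γ f) :
    Pop (piStar μ n) act f = (Pop μ act)^[n + 1] f := by
  induction n generalizing f with
  | zero => rfl
  | succ n ih =>
    rw [Function.iterate_succ_apply, ← ih (H.memB_Pop hl hγ h1 h2 hf)]
    funext x
    have hi : Integrable (fun g => f (act g x)) (piStar μ (n + 1)) :=
      H.integrable_comp_act hl hγ (H.integrable_lip_mul_piStar hl.le hγ h1 _)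
        (H.integrable_deltaFun_rpow_piStar hl.le (by positivity) h2 _) hf x
    have hi' := (integrable_map_measure hi.aestronglyMeasurable
      measurable_mul.aemeasurable).1 hi
    calc Pop (piStar μ (n + 1)) act f x
        = ∫ q : G × G, f (act (q.1 * q.2) x) ∂(μ.prod (piStar μ n)) :=
          integral_map measurable_mul.aemeasurable hi.aestronglyMeasurable
      _ = ∫ h, ∫ g, f (act (g * h) x) ∂μ ∂(piStar μ n) := integral_prod_symm _ hi'
      _ = Pop (piStar μ n) act (Pop μ act f) x := by simp only [H.mul_act, Pop]

lemma iterate_Pop_piStar [IsProbabilityMeasure μ] (H : IsLipAction act c) (hl : 0 < lam)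
    (hγ : 0 ≤ γ)
    (h1 : Integrable (fun g => c g * deltaFun x₀ act c lam g ^ (2 * γ)) μ)
    (h2 : Integrable (fun g => deltaFun x₀ act c lam g ^ (γ + 1)) μ) (n k : ℕ)
    {f : M → ℂ} (hf : memB x₀ lam γ f) :
    (Pop (piStar μ n) act)^[k] f = (Pop μ act)^[(n + 1) * k] f := by
  induction k generalizing f with
  | zero => rfl
  | succ k ih =>
    rw [Function.iterate_succ_apply, H.Pop_piStar hl hγ h1 h2 n hf,
      ih (H.iterate_Pop hl hγ h1 h2 hf (n + 1)).1, ← Function.iterate_add_apply, mul_add_one]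

/-- Contraction of the seminorm by the `(n + 1)`-st convolution power controls all iterates. -/
lemma mGam_iterate_le [IsProbabilityMeasure μ] (H : IsLipAction act c) (hl : 0 < lam)
    (hγ : 0 ≤ γ)
    (h1 : Integrable (fun g => c g * deltaFun x₀ act c lam g ^ (2 * γ)) μ)
    (h2 : Integrable (fun g => deltaFun x₀ act c lam g ^ (γ + 1)) μ) {n : ℕ} {θ : ℝ}
    (hθ : ∫ g, c g * deltaFun x₀ act c lam g ^ (2 * γ) ∂(piStar μ n) ≤ θ)
    {f : M → ℂ} (hf : memB x₀ lam γ f) (k : ℕ) :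
    mGam x₀ lam γ ((Pop μ act)^[k] f)
      ≤ θ ^ (k / (n + 1)) * (∫ g, c g * deltaFun x₀ act c lam g ^ (2 * γ) ∂μ) ^ (k % (n + 1))
        * mGam x₀ lam γ f := by
  have hr := H.iterate_Pop hl hγ h1 h2 hf (k % (n + 1))
  have hq := H.iterate_Pop (μ := piStar μ n) hl hγ (H.integrable_lip_mul_piStar hl.le hγ h1 n)
    (H.integrable_deltaFun_rpow_piStar hl.le (by positivity) h2 n) hr.1 (k / (n + 1))
  rw [H.iterate_Pop_piStar hl hγ h1 h2 n _ hr.1, ← Function.iterate_add_apply,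
    Nat.div_add_mod] at hq
  have h0 := H.integral_lip_mul_nonneg (x₀ := x₀) (γ := γ) (μ := piStar μ n) hl.le
  rw [mul_assoc]
  exact hq.2.trans (mul_le_mul (pow_le_pow_left₀ h0 hθ _) hr.2 (mGam_nonneg hl.le _)
    (pow_nonneg (h0.trans hθ) _))

end IsLipAction

end Convolution

end Operator

section Invariance

variable {M G : Type*} [MetricSpace M] [MeasurableSpace M] [Semigroup G] [MeasurableSpace G]
  {act : G → M → M} {c : G → ℝ} {μ : Measure G} {ν : Measure M}

namespace IsLipAction

/-- A `μ`-invariant measure is invariant under the convolution powers of `μ`. -/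
lemma lintegral_piStar_of_invariant [IsProbabilityMeasure μ] [MeasurableMul₂ G]
    (H : IsLipAction act c)
    [IsProbabilityMeasure ν]
    (hν : Measure.map (fun q : G × M => act q.1 q.2) (μ.prod ν) = ν) (n : ℕ)
    {W : M → ℝ≥0∞} (hW : Measurable W) :
    ∫⁻ x, ∫⁻ g, W (act g x) ∂(piStar μ n) ∂ν = ∫⁻ x, W x ∂ν := by
  have hWm : ∀ {W : M → ℝ≥0∞}, Measurable W → Measurable fun q : G × M => W (act q.1 q.2) :=
    fun hW => hW.comp H.measurable_act
  have hone : ∀ {W : M → ℝ≥0∞}, Measurable W →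
      ∫⁻ x, ∫⁻ g, W (act g x) ∂μ ∂ν = ∫⁻ x, W x ∂ν := fun {W} hW => by
    conv_rhs => rw [← hν, lintegral_map hW H.measurable_act,
      lintegral_prod_symm' _ (hWm hW)]
  induction n generalizing W with
  | zero => exact hone hW
  | succ n ih =>
    have hQ : Measurable fun x => ∫⁻ g, W (act g x) ∂μ := (hWm hW).lintegral_prod_left'
    rw [← hone hW, ← ih hQ]
    refine lintegral_congr fun x => ?_
    have hx : Measurable fun g => W (act g x) := hW.comp (H.measurable_act_left x)
    have hx2 : Measurable fun q : G × G => W (act (q.1 * q.2) x) := hx.comp measurable_mul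
    rw [piStar, lintegral_map hx measurable_mul, lintegral_prod_symm' _ hx2]
    simp only [H.mul_act]

lemma integral_Pop_of_invariant [IsProbabilityMeasure μ] [IsProbabilityMeasure ν]
    (H : IsLipAction act c)
    (hν : Measure.map (fun q : G × M => act q.1 q.2) (μ.prod ν) = ν) {f : M → ℂ}
    (hf : Integrable f ν) : ∫ x, Pop μ act f x ∂ν = ∫ x, f x ∂ν := by
  have hm : AEStronglyMeasurable f (Measure.map (fun q : G × M => act q.1 q.2) (μ.prod ν)) := by
    rw [hν]
    exact hf.aestronglyMeasurable
  have hi : Integrable (fun q : G × M => f (act q.1 q.2)) (μ.prod ν) := by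
    refine (integrable_map_measure hm H.measurable_act.aemeasurable).1 ?_
    rwa [hν]
  calc ∫ x, Pop μ act f x ∂ν = ∫ q : G × M, f (act q.1 q.2) ∂(μ.prod ν) :=
        (integral_prod_symm _ hi).symm
    _ = ∫ x, f x ∂(Measure.map (fun q : G × M => act q.1 q.2) (μ.prod ν)) :=
        (integral_map H.measurable_act.aemeasurable hm).symm
    _ = ∫ x, f x ∂ν := by rw [hν]

end IsLipAction

end Invariance

section Invariant

variable {M G : Type*} [MetricSpace M] [MeasurableSpace M] [BorelSpace M]
  [Semigroup G] [MeasurableSpace G]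
  {x₀ : M} {act : G → M → M} {c : G → ℝ} {lam γ : ℝ} {μ : Measure G} {ν : Measure M}

namespace IsLipAction

lemma integrable_wDelta_of_invariant [IsProbabilityMeasure μ] [IsProbabilityMeasure ν]
    (H : IsLipAction act c) (hl : 0 < lam) (hγ : 0 ≤ γ)
    (hinv : ∀ W : M → ℝ≥0∞, Measurable W →
      ∫⁻ x, ∫⁻ g, W (act g x) ∂μ ∂ν = ∫⁻ x, W x ∂ν)
    (h1 : Integrable (fun g => c g * deltaFun x₀ act c lam g ^ (2 * γ)) μ)
    (h2 : Integrable (fun g => deltaFun x₀ act c lam g ^ (γ + 1)) μ)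
    (hlt : ∫ g, c g * deltaFun x₀ act c lam g ^ (2 * γ) ∂μ < 1) :
    Integrable (fun x => wDelta x₀ lam γ x x₀) ν := by
  set θ := ∫ g, c g * deltaFun x₀ act c lam g ^ (2 * γ) ∂μ with hθ
  set S := ∫ g, deltaFun x₀ act c lam g ^ (γ + 1) ∂μ with hS
  have hθ0 : 0 ≤ θ := H.integral_lip_mul_nonneg hl.le
  have hS0 : 0 ≤ S := integral_nonneg fun g =>
    Real.rpow_nonneg (zero_le_one.trans (one_le_deltaFun hl.le g)) _
  have hw0 := fun x : M => wDelta_nonneg (x₀ := x₀) (γ := γ) hl.le x x₀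
  have hwm : Measurable fun x : M => wDelta x₀ lam γ x x₀ :=
    (continuous_wDelta_left hl.le x₀).measurable
  have hL : 0 ≤ lam⁻¹ * S := by positivity
  set ε := (1 - θ) / (2 * (lam⁻¹ * S + 1)) with hε
  have hε0 : 0 < ε := div_pos (by linarith) (by positivity)
  have hκ : θ + lam⁻¹ * S * ε < 1 := by
    have : (lam⁻¹ * S + 1) * ε = (1 - θ) / 2 := by
      rw [hε]
      field_simp
    nlinarith
  set C := (1 + lam * ε⁻¹) ^ γ with hC
  have hC0 : 0 ≤ C := by positivity
  have hreal : ∀ x, ∫⁻ g, ENNReal.ofReal (wDelta x₀ lam γ (act g x) x₀) ∂μ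
      ≤ ENNReal.ofReal ((θ + lam⁻¹ * S * ε) * wDelta x₀ lam γ x x₀ + lam⁻¹ * S * C) := by
    intro x
    have hi := (h1.mul_const (wDelta x₀ lam γ x x₀)).add
      ((h2.const_mul lam⁻¹).mul_const (pfun x₀ lam x ^ γ))
    calc ∫⁻ g, ENNReal.ofReal (wDelta x₀ lam γ (act g x) x₀) ∂μ
        ≤ ∫⁻ g, ENNReal.ofReal (c g * deltaFun x₀ act c lam g ^ (2 * γ) * wDelta x₀ lam γ x x₀
            + lam⁻¹ * deltaFun x₀ act c lam g ^ (γ + 1) * pfun x₀ lam x ^ γ) ∂μ :=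
          lintegral_mono fun g => ENNReal.ofReal_le_ofReal (H.wDelta_act_base_le hl hγ g x)
      _ = ENNReal.ofReal (θ * wDelta x₀ lam γ x x₀ + lam⁻¹ * S * pfun x₀ lam x ^ γ) := by
          rw [hθ, hS, ← integral_mul_const, ← integral_const_mul, ← integral_mul_const,
            ← integral_add (h1.mul_const _) ((h2.const_mul _).mul_const _)]
          exact (ofReal_integral_eq_lintegral_ofReal hi (ae_of_all _ fun g =>
            (wDelta_nonneg hl.le _ _).trans (H.wDelta_act_base_le hl hγ g x))).symm
      _ ≤ _ := by
          refine ENNReal.ofReal_le_ofReal ?_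
          have := mul_le_mul_of_nonneg_left
            (pfun_rpow_le_mul_wDelta_add (x₀ := x₀) hl.le hγ hε0 x) hL
          linarith
  have key := lintegral_lt_top_of_drift (act := act) hinv hwm.ennreal_ofReal
    (fun x => (hwm.comp (H.measurable_act_left x)).ennreal_ofReal)
    (fun x => ENNReal.ofReal_ne_top) (κ := ENNReal.ofReal (θ + lam⁻¹ * S * ε))
    (B := ENNReal.ofReal (lam⁻¹ * S * C))
    (by rwa [ENNReal.ofReal_lt_one]) ENNReal.ofReal_ne_top (fun x => by
      rw [← ENNReal.ofReal_mul (by positivity), ← ENNReal.ofReal_add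
        (mul_nonneg (by positivity) (hw0 x)) (by positivity)]
      exact hreal x)
  refine ⟨hwm.aestronglyMeasurable, ?_⟩
  rwa [hasFiniteIntegral_iff_ofReal (ae_of_all _ hw0)]

end IsLipAction

lemma memB.integrable [IsFiniteMeasure ν] (hl : 0 ≤ lam)
    (hw : Integrable (fun x => wDelta x₀ lam γ x x₀) ν)
    {f : M → ℂ} (hf : memB x₀ lam γ f) : Integrable f ν :=
  ((integrable_const _).add (hw.const_mul _)).mono'
    (hf.continuous hl).measurable.aestronglyMeasurable (ae_of_all _ (hf.norm_le hl))

end Invariant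

/-- Geometric decay along multiples of `N` upgrades to geometric decay at rate close to
`θ ^ (1 / N)`. -/
lemma exists_pow_div_mul_pow_mod_le {θ K : ℝ} (hθ : 0 ≤ θ) (hK : 0 ≤ K) {N : ℕ} (hN : 0 < N)
    {ε : ℝ} (hε : 0 < ε) :
    ∃ C : ℝ, 1 ≤ C ∧ ∀ n : ℕ,
      θ ^ (n / N) * K ^ (n % N) ≤ C * (θ ^ (1 / (N : ℝ)) + ε) ^ n := by
  set s := θ ^ (1 / (N : ℝ)) with hs
  have hs0 : 0 ≤ s := Real.rpow_nonneg hθ _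
  have hsN : s ^ N = θ := by
    rw [hs, one_div, Real.rpow_inv_natCast_pow hθ hN.ne']
  have hsε : 0 < s + ε := by positivity
  set L := max (K / (s + ε)) 1 with hL
  refine ⟨L ^ N, one_le_pow₀ (le_max_right _ _), fun n => ?_⟩
  have hKL : K ≤ L * (s + ε) := (div_le_iff₀ hsε).1 (le_max_left _ _)
  have hL0 : 0 ≤ L := zero_le_one.trans (le_max_right _ _)
  calc θ ^ (n / N) * K ^ (n % N)
      ≤ ((s + ε) ^ N) ^ (n / N) * (L * (s + ε)) ^ (n % N) := by
        gcongr
        rw [← hsN]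
        gcongr
        linarith
    _ = L ^ (n % N) * (s + ε) ^ n := by
        rw [mul_pow]
        conv_rhs => rw [← Nat.div_add_mod n N, Nat.mul_add_mod, Nat.mod_mod, pow_add, pow_mul]
        ring
    _ ≤ L ^ N * (s + ε) ^ n := by
        gcongr
        · exact le_max_right _ _
        · exact (Nat.mod_lt n hN).le

/-- Theorem 5.5: `P` is bounded on `𝓑_γ`, `𝓑_γ = ℂ·1 ⊕ H_γ` with
`H_γ = {f : ν(f) = 0}` a closed `P`-invariant subspace on which the spectral radius of `P`
is `≤ ϑ₀^{1/n₀} < 1`; equivalently `Pⁿ f = ν(f)·1 + N_{(γ)}ⁿ f`.  (`piStar π n₀ = π^{*(n₀+1)}`,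
so `ϑ₀^{1/(n₀+1)}` here corresponds to the paper's `ϑ₀^{1/n₀}`.) -/
theorem stmt6
    {M : Type*} [MetricSpace M] [ProperSpace M] [MeasurableSpace M] [BorelSpace M]
    {G : Type*} [Semigroup G] [MeasurableSpace G] [MeasurableMul₂ G]
    (x₀ : M) (act : G → M → M)
    (hact : ∀ (g h : G) (x : M), act (g * h) x = act g (act h x))
    (hactm : Measurable fun q : G × M => act q.1 q.2)
    (c : G → ℝ) (hcm : Measurable c)
    (hc0 : ∀ g : G, 0 ≤ c g)
    (hcLip : ∀ (g : G) (x y : M), dist (act g x) (act g y) ≤ c g * dist x y)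
    (hcMin : ∀ (g : G) (K : ℝ), 0 ≤ K →
      (∀ x y : M, dist (act g x) (act g y) ≤ K * dist x y) → c g ≤ K)
    (π : Measure G) [IsProbabilityMeasure π]
    -- condition 𝓗(γ₀)
    (γ₀ : ℝ) (hγ₀ : 0 < γ₀) (n₀ : ℕ)
    (hM : ∫⁻ g, ENNReal.ofReal (deltaTilde x₀ act c g ^ (γ₀ + 1)) ∂π < ⊤)
    (hM' : ∫⁻ g, ENNReal.ofReal (c g * deltaTilde x₀ act c g ^ (2 * γ₀)) ∂π < ⊤)
    (hC : ∫⁻ g, ENNReal.ofReal (c g * max (c g) 1 ^ (2 * γ₀)) ∂(piStar π n₀) < 1)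
    -- `λ₀ ∈ (0,1]` with `ϑ₀ < 1`
    (lam₀ : ℝ) (hlam₀ : 0 < lam₀) (hlam₀' : lam₀ ≤ 1)
    (hθint : Integrable (fun g => c g * deltaFun x₀ act c lam₀ g ^ (2 * γ₀)) (piStar π n₀))
    (hθ : theta0 x₀ act c π lam₀ γ₀ n₀ < 1)
    -- the `P`-invariant probability measure
    (ν : Measure M) [IsProbabilityMeasure ν]
    (hν : Measure.map (fun q : G × M => act q.1 q.2) (π.prod ν) = ν)
    (γ : ℝ) (hγpos : 0 < γ) (hγle : γ ≤ γ₀) :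
    -- `P` is a bounded linear operator of `𝓑_γ`
    (∀ f : M → ℂ, memB x₀ lam₀ γ f → memB x₀ lam₀ γ (Pop π act f)) ∧
    (∃ C : ℝ, ∀ f : M → ℂ, memB x₀ lam₀ γ f →
      nNu x₀ lam₀ γ ν (Pop π act f) ≤ C * nNu x₀ lam₀ γ ν f) ∧
    -- `H_γ` is `P`-invariant
    (∀ f : M → ℂ, memB x₀ lam₀ γ f → (∫ x, f x ∂ν) = 0 →
      (∫ x, Pop π act f x ∂ν) = 0) ∧
    -- `H_γ` is closed in `(𝓑_γ, N_γ)`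
    (∀ (u : ℕ → M → ℂ) (f : M → ℂ),
      (∀ n, memB x₀ lam₀ γ (u n) ∧ (∫ x, u n x ∂ν) = 0) → memB x₀ lam₀ γ f →
      Tendsto (fun n => nNu x₀ lam₀ γ ν (u n - f)) atTop (𝓝 0) →
      (∫ x, f x ∂ν) = 0) ∧
    -- spectral radius of `P` restricted to `H_γ` is `≤ ϑ₀^{1/n₀} < 1`
    (theta0 x₀ act c π lam₀ γ₀ n₀ ^ (1 / ((n₀ : ℝ) + 1)) < 1) ∧
    (∀ ε : ℝ, 0 < ε → ∃ C : ℝ, ∀ (n : ℕ) (f : M → ℂ), memB x₀ lam₀ γ f →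
      (∫ x, f x ∂ν) = 0 →
      nNu x₀ lam₀ γ ν ((Pop π act)^[n] f)
        ≤ C * (theta0 x₀ act c π lam₀ γ₀ n₀ ^ (1 / ((n₀ : ℝ) + 1)) + ε) ^ n
            * nNu x₀ lam₀ γ ν f) ∧
    -- equivalently, `Pⁿ f = ν(f)·1 + N_{(γ)}ⁿ f` with `N_{(γ)}` linear of small spectral radius
    (∃ Nop : (M → ℂ) → M → ℂ,
      (∀ f : M → ℂ, memB x₀ lam₀ γ f → memB x₀ lam₀ γ (Nop f)) ∧
      (∀ f h : M → ℂ, memB x₀ lam₀ γ f → memB x₀ lam₀ γ h →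
        Nop (f + h) = Nop f + Nop h) ∧
      (∀ (a : ℂ) (f : M → ℂ), memB x₀ lam₀ γ f → Nop (a • f) = a • Nop f) ∧
      (∀ (n : ℕ), 1 ≤ n → ∀ f : M → ℂ, memB x₀ lam₀ γ f → ∀ x : M,
        (Pop π act)^[n] f x = (∫ y, f y ∂ν) + (Nop)^[n] f x) ∧
      (∀ ε : ℝ, 0 < ε → ∃ C : ℝ, ∀ (n : ℕ) (f : M → ℂ), memB x₀ lam₀ γ f →
        nNu x₀ lam₀ γ ν ((Nop)^[n] f)
          ≤ C * (theta0 x₀ act c π lam₀ γ₀ n₀ ^ (1 / ((n₀ : ℝ) + 1)) + ε) ^ n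
              * nNu x₀ lam₀ γ ν f)) := by
  have H : IsLipAction act c := ⟨hact, hactm, hcm, hc0, hcLip, hcMin⟩
  have hγ := hγpos.le
  have hδ1 : ∀ g, 1 ≤ deltaFun x₀ act c lam₀ g := one_le_deltaFun hlam₀.le
  have hδ0 : ∀ g, 0 ≤ deltaFun x₀ act c lam₀ g := fun g => zero_le_one.trans (hδ1 g)
  have hδm : Measurable (deltaFun x₀ act c lam₀) := H.measurable_deltaFun
  have hcδ0 : ∀ (s : ℝ) (g : G), 0 ≤ c g * deltaFun x₀ act c lam₀ g ^ s := fun s g =>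
    mul_nonneg (hc0 g) (Real.rpow_nonneg (hδ0 g) s)
  have hpow : ∀ {s t : ℝ}, s ≤ t → 0 ≤ t → ∀ g,
      deltaFun x₀ act c lam₀ g ^ s ≤ deltaTilde x₀ act c g ^ t := fun hst ht g =>
    (Real.rpow_le_rpow_of_exponent_le (hδ1 g) hst).trans
      (Real.rpow_le_rpow (hδ0 g) (H.deltaFun_le_deltaTilde hlam₀' g) ht)
  have h1 : Integrable (fun g => c g * deltaFun x₀ act c lam₀ g ^ (2 * γ)) π := by
    refine ⟨(hcm.mul (hδm.pow_const _)).aestronglyMeasurable, ?_⟩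
    rw [hasFiniteIntegral_iff_ofReal (ae_of_all _ (hcδ0 _))]
    refine (lintegral_mono fun g => ENNReal.ofReal_le_ofReal ?_).trans_lt hM'
    exact mul_le_mul_of_nonneg_left (hpow (by linarith) (by linarith) g) (hc0 g)
  have h2 : Integrable (fun g => deltaFun x₀ act c lam₀ g ^ (γ + 1)) π := by
    refine ⟨(hδm.pow_const _).aestronglyMeasurable, ?_⟩
    rw [hasFiniteIntegral_iff_ofReal (ae_of_all _ fun g => Real.rpow_nonneg (hδ0 g) _)]
    exact (lintegral_mono fun g => ENNReal.ofReal_le_ofReal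
      (hpow (by linarith) (by linarith) g)).trans_lt hM
  have h1' := H.integrable_lip_mul_piStar hlam₀.le hγ h1 n₀
  have h2' := H.integrable_deltaFun_rpow_piStar hlam₀.le (by positivity) h2 n₀
  set θ := theta0 x₀ act c π lam₀ γ₀ n₀ with hθdef
  have hθle : ∫ g, c g * deltaFun x₀ act c lam₀ g ^ (2 * γ) ∂(piStar π n₀) ≤ θ :=
    integral_mono h1' hθint fun g => mul_le_mul_of_nonneg_left
      (Real.rpow_le_rpow_of_exponent_le (hδ1 g) (by linarith)) (hc0 g)
  have hθ0 : 0 ≤ θ := integral_nonneg (hcδ0 _)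
  have hw : Integrable (fun x => wDelta x₀ lam₀ γ x x₀) ν :=
    H.integrable_wDelta_of_invariant hlam₀ hγ
      (fun _ hW => H.lintegral_piStar_of_invariant hν n₀ hW) h1' h2' (hθle.trans_lt hθ)
  have hint : ∀ {f : M → ℂ}, memB x₀ lam₀ γ f → Integrable f ν := fun hf =>
    hf.integrable hlam₀.le hw
  have hP : ∀ {f : M → ℂ}, memB x₀ lam₀ γ f → memB x₀ lam₀ γ (Pop π act f) := fun hf =>
    H.memB_Pop hlam₀ hγ h1 h2 hf
  have hPn : ∀ {f : M → ℂ}, memB x₀ lam₀ γ f → ∀ n, memB x₀ lam₀ γ ((Pop π act)^[n] f) :=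
    fun hf n => (H.iterate_Pop hlam₀ hγ h1 h2 hf n).1
  have hνP : ∀ {f : M → ℂ}, memB x₀ lam₀ γ f → ∫ x, Pop π act f x ∂ν = ∫ x, f x ∂ν :=
    fun hf => H.integral_Pop_of_invariant hν (hint hf)
  have hνPn : ∀ {f : M → ℂ}, memB x₀ lam₀ γ f → ∀ n,
      ∫ x, (Pop π act)^[n] f x ∂ν = ∫ x, f x ∂ν := fun hf n => by
    induction n with
    | zero => rfl
    | succ n ih => rw [Function.iterate_succ_apply', hνP (hPn hf n), ih]
  set K := ∫ g, c g * deltaFun x₀ act c lam₀ g ^ (2 * γ) ∂π with hK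
  have hK0 : 0 ≤ K := H.integral_lip_mul_nonneg hlam₀.le
  have hm0 : ∀ f : M → ℂ, 0 ≤ mGam x₀ lam₀ γ f := mGam_nonneg hlam₀.le
  have hrate : ∀ ε : ℝ, 0 < ε → ∃ C : ℝ, 1 ≤ C ∧ ∀ (n : ℕ) (f : M → ℂ),
      memB x₀ lam₀ γ f → mGam x₀ lam₀ γ ((Pop π act)^[n] f)
        ≤ C * (θ ^ (1 / ((n₀ : ℝ) + 1)) + ε) ^ n * nNu x₀ lam₀ γ ν f := by
    intro ε hε
    obtain ⟨C, hC1, hCn⟩ := exists_pow_div_mul_pow_mod_le hθ0 hK0 n₀.succ_pos hε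
    rw [Nat.cast_succ] at hCn
    refine ⟨C, hC1, fun n f hf => (H.mGam_iterate_le hlam₀ hγ h1 h2 hθle hf n).trans ?_⟩
    exact mul_le_mul (hCn n) (mGam_le_nNu ν f) (hm0 f)
      (mul_nonneg (by linarith) (pow_nonneg (by positivity) n))
  refine ⟨fun f hf => hP hf, ⟨max K 1, fun f hf => ?_⟩, fun f hf hf0 => (hνP hf).trans hf0,
    fun u f hu hf hlim => ?_, Real.rpow_lt_one hθ0 hθ (by positivity), fun ε hε => ?_, ?_⟩
  · unfold nNu
    rw [hνP hf, mul_add]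
    refine add_le_add ((H.mGam_Pop_le hlam₀ hγ h1 h2 hf).trans ?_) ?_
    · exact mul_le_mul_of_nonneg_right (le_max_left _ _) (hm0 f)
    · exact le_mul_of_one_le_left (norm_nonneg _) (le_max_right _ _)
  · have hle : ∀ n, ‖∫ x, f x ∂ν‖ ≤ nNu x₀ lam₀ γ ν (u n - f) := fun n => by
      have : ∫ x, (u n - f) x ∂ν = -∫ x, f x ∂ν := by
        simp only [Pi.sub_apply]
        rw [integral_sub (hint (hu n).1) (hint hf), (hu n).2, zero_sub]
      unfold nNu
      rw [this, norm_neg]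
      exact le_add_of_nonneg_left (hm0 _)
    exact norm_le_zero_iff.1 (ge_of_tendsto' hlim hle)
  · obtain ⟨C, -, hC⟩ := hrate ε hε
    refine ⟨C, fun n f hf hf0 => ?_⟩
    rw [nNu, hνPn hf, hf0, norm_zero, add_zero]
    exact hC n f hf
  · set Nop : (M → ℂ) → M → ℂ := fun f x => Pop π act f x - ∫ y, f y ∂ν with hNop
    have hNB : ∀ {f : M → ℂ}, memB x₀ lam₀ γ f → memB x₀ lam₀ γ (Nop f) := fun hf =>
      (hP hf).sub_const _
    have hcenter : ∀ {f : M → ℂ}, memB x₀ lam₀ γ f → ∀ n,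
        ∫ x, ((Pop π act)^[n] f x - ∫ y, f y ∂ν) ∂ν = 0 := fun hf n => by
      rw [integral_sub (hint (hPn hf n)) (integrable_const _), hνPn hf]
      simp
    have hNn : ∀ {f : M → ℂ}, memB x₀ lam₀ γ f → ∀ n,
        Nop^[n + 1] f = fun x => (Pop π act)^[n + 1] f x - ∫ y, f y ∂ν := by
      intro f hf n
      induction n with
      | zero => rfl
      | succ n ih =>
        rw [Function.iterate_succ_apply', ih]
        funext x
        rw [Function.iterate_succ_apply' (Pop π act) (n + 1)]
        simp only [hNop]
        rw [hcenter hf, sub_zero, Pop, integral_sub (H.integrable_comp_act hlam₀ hγ h1 h2 (hPn hf (n + 1)) x)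
          (integrable_const _)]
        simp [Pop]
    refine ⟨Nop, fun f hf => hNB hf, fun f h hf hh => ?_, fun a f hf => ?_, ?_, fun ε hε => ?_⟩
    · funext x
      simp only [hNop, Pop, Pi.add_apply]
      rw [integral_add (hint hf) (hint hh), integral_add
        (H.integrable_comp_act hlam₀ hγ h1 h2 hf x) (H.integrable_comp_act hlam₀ hγ h1 h2 hh x)]
      ring
    · funext x
      simp only [hNop, Pop, Pi.smul_apply, integral_smul, smul_sub]
    · intro n hn f hf x
      obtain ⟨k, rfl⟩ := Nat.exists_eq_add_of_le' hn
      rw [hNn hf]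
      ring
    · obtain ⟨C, hC1, hC⟩ := hrate ε hε
      refine ⟨C, fun n f hf => ?_⟩
      cases n with
      | zero =>
        simpa using le_mul_of_one_le_left ((hm0 f).trans (mGam_le_nNu ν f)) hC1
      | succ k =>
        rw [hNn hf, nNu, hcenter hf, mGam_sub_const, norm_zero, add_zero]
        exact hC _ f hf

end
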